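/- Let a > 0 and N ≥ 1 be a natural number. Let ν be a probability measure on [0,1] whose Lebesgue density ρ belongs to the discrete Lipschitz cone C_a, and let π_N ν denote the probability measure on [0,1] with Lebesgue density π_N ρ. Then d(π_N ν, ν) ≤ (e^{a/N} − 1)/2 ≤ (e^a − 1)/(2N). -/

import Mathlib

open MeasureTheory

/-- Total-variation distance between two measures:
`d(μ,ν) = (1/2)·sup{ |∫ f dμ − ∫ f dν| : f measurable, sup|f| ≤ 1 }`. -/
noncomputable def tvDist {X : Type*} [MeasurableSpace X] (μ ν : Measure X) : ℝ :=
  sSup {r : ℝ | ∃ f : X → ℝ, Measurable f ∧ (∀ x, |f x| ≤ 1) ∧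
    r = (1 / 2) * |(∫ x, f x ∂μ) - ∫ x, f x ∂ν|}

/-- The `i`-th Ulam box of the uniform partition of `[0,1]` into `N` pieces
(`i = 1,…,N`): `B_i = [(i−1)/N, i/N)` for `i < N` and `B_N = [(N−1)/N, 1]`. -/
def ulamBox (N i : ℕ) : Set ℝ :=
  if i = N then Set.Icc (((N : ℝ) - 1) / N) 1
  else Set.Ico (((i : ℝ) - 1) / N) ((i : ℝ) / N)

/-- The Ulam projection `π_N f = Σ_{i=1}^N (N·∫_{B_i} f dx)·1_{B_i}` onto piecewise
constant functions with respect to the uniform partition of `[0,1]`. -/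
noncomputable def ulamProj (N : ℕ) (f : ℝ → ℝ) : ℝ → ℝ := fun x =>
  ∑ i ∈ Finset.Icc 1 N, (ulamBox N i).indicator (fun _ => (N : ℝ) * ∫ y in ulamBox N i, f y) x

/-- The discrete Lipschitz cone `C_a`: strictly positive functions on `[0,1]` with
`φ(x) ≤ e^{a·|x−y|}·φ(y)` for all `x, y ∈ [0,1]`. -/
def lipCone (a : ℝ) (φ : ℝ → ℝ) : Prop :=
  (∀ x ∈ Set.Icc (0 : ℝ) 1, 0 < φ x) ∧
    ∀ x ∈ Set.Icc (0 : ℝ) 1, ∀ y ∈ Set.Icc (0 : ℝ) 1,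
      φ x ≤ Real.exp (a * |x - y|) * φ y

lemma ulam_mem_box {N i : ℕ} (hN : 1 ≤ N) {x : ℝ} (hx : x ∈ ulamBox N i) :
    (i : ℝ) - 1 ≤ N * x ∧ N * x ≤ i ∧ (i ≠ N → N * x < i) := by
  have hN' : (0 : ℝ) < N := by exact_mod_cast hN
  unfold ulamBox at hx
  split_ifs at hx with h
  · subst h
    obtain ⟨h1, h2⟩ := hx
    rw [div_le_iff₀ hN'] at h1
    refine ⟨by linarith, by nlinarith, fun h => absurd rfl h⟩
  · obtain ⟨h1, h2⟩ := hx
    rw [div_le_iff₀ hN'] at h1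
    rw [lt_div_iff₀ hN'] at h2
    exact ⟨by linarith, by linarith, fun _ => by linarith⟩

lemma ulam_box_sub {N i : ℕ} (hN : 1 ≤ N) (hi : i ∈ Finset.Icc 1 N) :
    ulamBox N i ⊆ Set.Icc 0 1 := by
  intro x hx
  have hN' : (0 : ℝ) < N := by exact_mod_cast hN
  obtain ⟨h1, h2, -⟩ := ulam_mem_box hN hx
  rw [Finset.mem_Icc] at hi
  have hi1 : (1 : ℝ) ≤ i := by exact_mod_cast hi.1
  have hi2 : (i : ℝ) ≤ N := by exact_mod_cast hi.2
  constructor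
  · by_contra h
    push Not at h
    nlinarith
  · by_contra h
    push Not at h
    nlinarith

lemma ulam_box_meas (N i : ℕ) : MeasurableSet (ulamBox N i) := by
  unfold ulamBox
  split_ifs
  · exact measurableSet_Icc
  · exact measurableSet_Ico

lemma ulam_box_vol {N i : ℕ} (hN : 1 ≤ N) :
    volume (ulamBox N i) = ENNReal.ofReal (1 / N) := by
  have hN' : (N : ℝ) ≠ 0 := by positivity
  unfold ulamBox
  split_ifs
  · rw [Real.volume_Icc]
    congr 1
    field_simp
    ring
  · rw [Real.volume_Ico]
    congr 1
    field_simp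
    ring

lemma ulam_exists_box {N : ℕ} (hN : 1 ≤ N) {x : ℝ} (hx : x ∈ Set.Icc (0 : ℝ) 1) :
    ∃ i ∈ Finset.Icc 1 N, x ∈ ulamBox N i := by
  have hN' : (0 : ℝ) < N := by exact_mod_cast hN
  by_cases h : ((N : ℝ) - 1) / N ≤ x
  · refine ⟨N, by simp [hN], ?_⟩
    simp only [ulamBox, if_true]
    exact ⟨h, hx.2⟩
  · push Not at h
    rw [lt_div_iff₀ hN'] at h
    have h0 : 0 ≤ x * N := mul_nonneg hx.1 hN'.le
    have h1 := Nat.floor_le h0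
    have h2 := Nat.lt_floor_add_one (x * N)
    have h3 : ⌊x * N⌋₊ + 1 < N := by
      have : ((⌊x * N⌋₊ + 1 : ℕ) : ℝ) < N := by push_cast; linarith
      exact_mod_cast this
    refine ⟨⌊x * N⌋₊ + 1, by simp; omega, ?_⟩
    unfold ulamBox
    rw [if_neg h3.ne]
    constructor
    · rw [div_le_iff₀ hN']
      push_cast
      linarith
    · rw [lt_div_iff₀ hN']
      push_cast
      linarith

lemma ulam_box_unique {N i j : ℕ} (hN : 1 ≤ N) (hi : i ∈ Finset.Icc 1 N)
    (hj : j ∈ Finset.Icc 1 N) {x : ℝ} (hx : x ∈ ulamBox N i) (hx' : x ∈ ulamBox N j) :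
    i = j := by
  obtain ⟨h1, h2, h3⟩ := ulam_mem_box hN hx
  obtain ⟨g1, g2, g3⟩ := ulam_mem_box hN hx'
  rw [Finset.mem_Icc] at hi hj
  rcases lt_trichotomy i j with h | h | h
  · have := h3 (by omega)
    have : (j : ℝ) < i + 1 := by linarith
    have : j < i + 1 := by exact_mod_cast this
    omega
  · exact h
  · have := g3 (by omega)
    have : (i : ℝ) < j + 1 := by linarith
    have : i < j + 1 := by exact_mod_cast this
    omega

lemma ulam_proj_eq {N i : ℕ} (hN : 1 ≤ N) (hi : i ∈ Finset.Icc 1 N) (ρ : ℝ → ℝ)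
    {x : ℝ} (hx : x ∈ ulamBox N i) : ulamProj N ρ x = N * ∫ y in ulamBox N i, ρ y := by
  unfold ulamProj
  rw [Finset.sum_eq_single_of_mem i hi]
  · rw [Set.indicator_of_mem hx]
  · intro j hj hji
    rw [Set.indicator_of_notMem]
    exact fun h => hji (ulam_box_unique hN hj hi h hx)

lemma ulam_proj_meas (N : ℕ) (ρ : ℝ → ℝ) : Measurable (ulamProj N ρ) := by
  unfold ulamProj
  exact Finset.measurable_sum _ fun i _ => measurable_const.indicator (ulam_box_meas N i)

lemma ulam_cone_cont {a : ℝ} {ρ : ℝ → ℝ} (hρ : lipCone a ρ) :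
    ContinuousOn ρ (Set.Icc 0 1) := by
  intro x hx
  have h1 : Filter.Tendsto (fun y => Real.exp (a * |y - x|) * ρ x)
      (nhdsWithin x (Set.Icc 0 1)) (nhds (ρ x)) := by
    have : Continuous (fun y => Real.exp (a * |y - x|) * ρ x) := by fun_prop
    have := this.tendsto x
    simp only [sub_self, abs_zero, mul_zero, Real.exp_zero, one_mul] at this
    exact this.mono_left nhdsWithin_le_nhds
  have h2 : Filter.Tendsto (fun y => Real.exp (-(a * |x - y|)) * ρ x)
      (nhdsWithin x (Set.Icc 0 1)) (nhds (ρ x)) := by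
    have : Continuous (fun y => Real.exp (-(a * |x - y|)) * ρ x) := by fun_prop
    have := this.tendsto x
    simp only [sub_self, abs_zero, mul_zero, neg_zero, Real.exp_zero, one_mul] at this
    exact this.mono_left nhdsWithin_le_nhds
  refine tendsto_of_tendsto_of_tendsto_of_le_of_le' h2 h1 ?_ ?_
  · filter_upwards [self_mem_nhdsWithin] with y hy
    have := hρ.2 x hx y hy
    rw [Real.exp_neg, inv_mul_le_iff₀ (Real.exp_pos _)]
    exact this
  · filter_upwards [self_mem_nhdsWithin] with y hy
    exact hρ.2 y hy x hx

lemma ulam_pointwise {a : ℝ} (ha : 0 < a) {N : ℕ} (hN : 1 ≤ N) {ρ : ℝ → ℝ}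
    (hρ : lipCone a ρ) {x : ℝ} (hx : x ∈ Set.Icc (0 : ℝ) 1) :
    0 ≤ ulamProj N ρ x ∧
    |ulamProj N ρ x - ρ x| ≤ (Real.exp (a / N) - 1) * ρ x := by
  have hN' : (0 : ℝ) < N := by exact_mod_cast hN
  obtain ⟨i, hi, hxi⟩ := ulam_exists_box hN hx
  rw [ulam_proj_eq hN hi ρ hxi]
  have hsub := ulam_box_sub hN hi
  have hvol := ulam_box_vol (i := i) hN
  have hfin : volume (ulamBox N i) ≠ ⊤ := by rw [hvol]; exact ENNReal.ofReal_ne_top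
  have hreal : volume.real (ulamBox N i) = 1 / N := by
    rw [measureReal_def, hvol, ENNReal.toReal_ofReal (by positivity)]
  have hint : IntegrableOn ρ (ulamBox N i) :=
    ((ulam_cone_cont hρ).integrableOn_compact isCompact_Icc).mono_set hsub
  have hdist : ∀ y ∈ ulamBox N i, a * |x - y| ≤ a / N := by
    intro y hy
    obtain ⟨h1, h2, -⟩ := ulam_mem_box hN hxi
    obtain ⟨g1, g2, -⟩ := ulam_mem_box hN hy
    rw [div_eq_mul_one_div]
    refine mul_le_mul_of_nonneg_left ?_ ha.le
    rw [le_div_iff₀ hN', ← abs_of_pos hN', ← abs_mul, abs_le]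
    constructor <;> nlinarith
  have hpos := hρ.1 x hx
  have hup : ∀ y ∈ ulamBox N i, ρ y ≤ Real.exp (a / N) * ρ x := by
    intro y hy
    refine (hρ.2 y (hsub hy) x hx).trans ?_
    rw [abs_sub_comm]
    exact mul_le_mul_of_nonneg_right (Real.exp_le_exp.2 (hdist y hy)) hpos.le
  have hlo : ∀ y ∈ ulamBox N i, (Real.exp (a / N))⁻¹ * ρ x ≤ ρ y := by
    intro y hy
    rw [inv_mul_le_iff₀ (Real.exp_pos _)]
    refine (hρ.2 x hx y (hsub hy)).trans ?_
    exact mul_le_mul_of_nonneg_right (Real.exp_le_exp.2 (hdist y hy)) (hρ.1 y (hsub hy)).le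
  have I1 := setIntegral_mono_on hint (integrableOn_const hfin) (ulam_box_meas N i) hup
  have I2 := setIntegral_mono_on (integrableOn_const hfin) hint (ulam_box_meas N i) hlo
  rw [setIntegral_const, hreal, smul_eq_mul] at I1 I2
  set J := ∫ y in ulamBox N i, ρ y
  have K1 : N * J ≤ Real.exp (a / N) * ρ x := by
    have := mul_le_mul_of_nonneg_left I1 hN'.le
    rwa [← mul_assoc, mul_one_div_cancel hN'.ne', one_mul] at this
  have K2 : (Real.exp (a / N))⁻¹ * ρ x ≤ N * J := by
    have := mul_le_mul_of_nonneg_left I2 hN'.le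
    rwa [← mul_assoc, mul_one_div_cancel hN'.ne', one_mul] at this
  have hE := Real.exp_pos (a / N)
  refine ⟨le_trans (by positivity) K2, ?_⟩
  have hE2 : 2 - Real.exp (a / N) ≤ (Real.exp (a / N))⁻¹ := by
    rw [← one_div, le_div_iff₀ hE]
    nlinarith [sq_nonneg (Real.exp (a / N) - 1)]
  have := mul_le_mul_of_nonneg_right hE2 hpos.le
  rw [abs_le]
  constructor <;> linarith

/-- If `ν` is a probability measure on `[0,1]` with Lebesgue density `ρ ∈ C_a` and
`π_N ν` is the measure with density `π_N ρ`, then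
`d(π_N ν, ν) ≤ (e^{a/N} − 1)/2 ≤ (e^a − 1)/(2N)`. -/
theorem ulam_projection_tv_error (a : ℝ) (ha : 0 < a) (N : ℕ) (hN : 1 ≤ N)
    (ρ : ℝ → ℝ) (hρ : lipCone a ρ)
    (ν : Measure ℝ) [IsProbabilityMeasure ν]
    (hν : ν = (volume.restrict (Set.Icc (0 : ℝ) 1)).withDensity
      fun x => ENNReal.ofReal (ρ x))
    (νN : Measure ℝ)
    (hνN : νN = (volume.restrict (Set.Icc (0 : ℝ) 1)).withDensity
      fun x => ENNReal.ofReal (ulamProj N ρ x)) :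
    tvDist νN ν ≤ (Real.exp (a / N) - 1) / 2 ∧
      (Real.exp (a / N) - 1) / 2 ≤ (Real.exp a - 1) / (2 * N) := by
  have hN' : (0 : ℝ) < N := by exact_mod_cast hN
  have hE1 : 1 ≤ Real.exp (a / N) := Real.one_le_exp (by positivity)
  constructor
  · set lam := (volume.restrict (Set.Icc (0 : ℝ) 1)) with hlam
    have hmem : ∀ᵐ x ∂lam, x ∈ Set.Icc (0 : ℝ) 1 := ae_restrict_mem measurableSet_Icc
    have hρi : Integrable ρ lam := (ulam_cone_cont hρ).integrableOn_compact isCompact_Icc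
    have hρ0 : 0 ≤ᵐ[lam] ρ := by
      filter_upwards [hmem] with x hx using (hρ.1 x hx).le
    have hρ1 : ∫ x, ρ x ∂lam = 1 := by
      rw [integral_eq_lintegral_of_nonneg_ae hρ0 hρi.aestronglyMeasurable]
      have h : ν Set.univ = 1 := measure_univ
      rw [hν, withDensity_apply _ MeasurableSet.univ, Measure.restrict_univ] at h
      rw [h, ENNReal.toReal_one]
    have hPm := ulam_proj_meas N ρ
    have hDi : Integrable (fun x => ulamProj N ρ x - ρ x) lam := by
      refine (hρi.const_mul (Real.exp (a / N) - 1)).mono'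
        (hPm.aestronglyMeasurable.sub hρi.aestronglyMeasurable) ?_
      filter_upwards [hmem] with x hx using (ulam_pointwise ha hN hρ hx).2
    have hPi : Integrable (ulamProj N ρ) lam := by
      refine (hDi.add hρi).congr (Filter.Eventually.of_forall fun x => ?_)
      simp
    unfold tvDist
    refine Real.sSup_le ?_ (by linarith)
    rintro r ⟨f, hf, hf1, rfl⟩
    have e1 : ∫ x, f x ∂νN = ∫ x, f x * ulamProj N ρ x ∂lam := by
      rw [hνN, integral_withDensity_eq_integral_toReal_smul₀ hPm.ennreal_ofReal.aemeasurable
        (by simp)]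
      refine integral_congr_ae ?_
      filter_upwards [hmem] with x hx
      rw [ENNReal.toReal_ofReal (ulam_pointwise ha hN hρ hx).1, smul_eq_mul, mul_comm]
    have e2 : ∫ x, f x ∂ν = ∫ x, f x * ρ x ∂lam := by
      rw [hν, integral_withDensity_eq_integral_toReal_smul₀ hρi.aemeasurable.ennreal_ofReal
        (by simp)]
      refine integral_congr_ae ?_
      filter_upwards [hmem] with x hx
      rw [ENNReal.toReal_ofReal (hρ.1 x hx).le, smul_eq_mul, mul_comm]
    have hb : ∀ᵐ x ∂lam, ‖f x‖ ≤ 1 := Filter.Eventually.of_forall hf1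
    rw [e1, e2, ← integral_sub (hPi.bdd_mul hf.aestronglyMeasurable hb)
      (hρi.bdd_mul hf.aestronglyMeasurable hb)]
    have key : ‖∫ x, (f x * ulamProj N ρ x - f x * ρ x) ∂lam‖
        ≤ ∫ x, (Real.exp (a / N) - 1) * ρ x ∂lam := by
      refine norm_integral_le_of_norm_le (hρi.const_mul _) ?_
      filter_upwards [hmem] with x hx
      rw [← mul_sub, norm_mul, Real.norm_eq_abs, Real.norm_eq_abs]
      refine le_trans ?_ (ulam_pointwise ha hN hρ hx).2
      exact mul_le_of_le_one_left (abs_nonneg _) (hf1 x)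
    rw [integral_const_mul, hρ1, mul_one, Real.norm_eq_abs] at key
    linarith
  · have h := one_add_mul_le_pow (a := Real.exp (a / N) - 1) (by linarith) N
    have h2 : (1 + (Real.exp (a / N) - 1)) ^ N = Real.exp a := by
      rw [add_sub_cancel, ← Real.exp_nat_mul, mul_div_cancel₀ _ hN'.ne']
    rw [h2] at h
    rw [div_le_div_iff₀ (by norm_num) (by positivity)]
    linarith
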